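/- arXiv:1008.2838 — 5 statements merged into one kernel-verified Lean document; each statement's English description precedes it below -/
import Mathlib

section
/- (Proposition, part 1.) Let T : (Fin k → ℤ) →₀ M and S : (Fin k → ℤ) →₀ N be boost-weight decomposed tensors over a commutative ring R, let i ≤ j ≤ k, and suppose T possesses the S_i-property and S possesses the S_j-property. Then for any R-bilinear map B : M → N → P, the product T·S (modeling the tensor product T ⊗ S) possesses the S_i-property. -/
/-- The product of two boost-weight decomposed tensors `T : (Fin k → ℤ) →₀ M` and
`S : (Fin k → ℤ) →₀ N` with respect to a bilinear map `B : M →ₗ N →ₗ P`, modeling the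
tensor product: the component of boost weight `b` is `Σ_{b₁ + b₂ = b} B (T b₁) (S b₂)`. -/
noncomputable def boostProd {k : ℕ} {R M N P : Type*} [CommRing R]
    [AddCommGroup M] [Module R M] [AddCommGroup N] [Module R N]
    [AddCommGroup P] [Module R P] (B : M →ₗ[R] N →ₗ[R] P)
    (T : (Fin k → ℤ) →₀ M) (S : (Fin k → ℤ) →₀ N) : (Fin k → ℤ) →₀ P :=
  T.sum fun b₁ m => S.sum fun b₂ n => Finsupp.single (b₁ + b₂) (B m n)

/-- Restriction to an initial segment of coordinates is monotone for the lexicographic order. -/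
theorem toLex_comp_castLE_le_toLex_comp_castLE {α : Type*} [LinearOrder α] {i j : ℕ} (h : i ≤ j)
    {x y : Fin j → α} (hxy : toLex x ≤ toLex y) :
    toLex (x ∘ Fin.castLE h) ≤ toLex (y ∘ Fin.castLE h) := by
  contrapose! hxy
  obtain ⟨l, hl, hlt⟩ := hxy
  exact ⟨Fin.castLE h l, fun m hm => hl ⟨m, lt_trans hm l.isLt⟩ hm, hlt⟩

/-- Every boost weight of a product is a sum of boost weights of the factors. -/
theorem exists_add_eq_of_mem_support_boostProd {k : ℕ} {R M N P : Type*} [CommRing R]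
    [AddCommGroup M] [Module R M] [AddCommGroup N] [Module R N]
    [AddCommGroup P] [Module R P] {B : M →ₗ[R] N →ₗ[R] P}
    {T : (Fin k → ℤ) →₀ M} {S : (Fin k → ℤ) →₀ N} {b : Fin k → ℤ}
    (hb : b ∈ (boostProd B T S).support) :
    ∃ b₁ ∈ T.support, ∃ b₂ ∈ S.support, b₁ + b₂ = b := by
  classical
  obtain ⟨b₁, h₁, hb⟩ := Finset.mem_biUnion.mp (Finsupp.support_sum hb)
  obtain ⟨b₂, h₂, hb⟩ := Finset.mem_biUnion.mp (Finsupp.support_sum hb)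
  exact ⟨b₁, h₁, b₂, h₂, (Finset.mem_singleton.mp (Finsupp.support_single_subset hb)).symm⟩

/-- Proposition, part 1: if `T` possesses the `S_i`-property and `S` the `S_j`-property,
with `i ≤ j ≤ k`, then the product `T·S` (modeling `T ⊗ S`) possesses the `S_i`-property. -/
theorem boostProd_sProp_of_sProp_sProp {k : ℕ} {R M N P : Type*} [CommRing R]
    [AddCommGroup M] [Module R M] [AddCommGroup N] [Module R N]
    [AddCommGroup P] [Module R P] (B : M →ₗ[R] N →ₗ[R] P)
    (T : (Fin k → ℤ) →₀ M) (S : (Fin k → ℤ) →₀ N)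
    {i j : ℕ} (hij : i ≤ j) (hjk : j ≤ k)
    (hT : ∀ b ∈ T.support, toLex (b ∘ Fin.castLE (hij.trans hjk)) ≤ toLex 0)
    (hS : ∀ b ∈ S.support, toLex (b ∘ Fin.castLE hjk) ≤ toLex 0) :
    ∀ b ∈ (boostProd B T S).support,
      toLex (b ∘ Fin.castLE (hij.trans hjk)) ≤ toLex 0 := by
  intro b hb
  obtain ⟨b₁, h₁, b₂, h₂, rfl⟩ := exists_add_eq_of_mem_support_boostProd hb
  exact add_nonpos (hT b₁ h₁) (toLex_comp_castLE_le_toLex_comp_castLE hij (hS b₂ h₂))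
end

section
/- (Proposition, part 2, second clause.) Let T : (Fin k → ℤ) →₀ M and S : (Fin k → ℤ) →₀ N be boost-weight decomposed tensors over a commutative ring R, and suppose T possesses the S_k-property (i.e. every b in its support satisfies toLex b ≤ 0) and S possesses the N-property. Then for any R-bilinear map B : M → N → P, the product T·S possesses the N-property. -/
/-- Proposition, part 2, second clause: if `T` possesses the `S_k`-property
(every boost weight in its support is lexicographically `≤ 0`) and `S` the `N`-property
(every boost weight in its support is lexicographically `< 0`), then the product `T·S`
(modeling `T ⊗ S`) possesses the `N`-property. -/
theorem boostProd_nProp_of_sProp_nProp {k : ℕ} {R M N P : Type*} [CommRing R]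
    [AddCommGroup M] [Module R M] [AddCommGroup N] [Module R N]
    [AddCommGroup P] [Module R P] (B : M →ₗ[R] N →ₗ[R] P)
    (T : (Fin k → ℤ) →₀ M) (S : (Fin k → ℤ) →₀ N)
    (hT : ∀ b ∈ T.support, toLex b ≤ toLex 0)
    (hS : ∀ b ∈ S.support, toLex b < toLex 0) :
    ∀ b ∈ (boostProd B T S).support, toLex b < toLex 0 := by
  classical
  intro b hb
  obtain ⟨b₁, hb₁, hb⟩ := Finset.mem_biUnion.mp (Finsupp.support_sum hb)
  obtain ⟨b₂, hb₂, hb⟩ := Finset.mem_biUnion.mp (Finsupp.support_sum hb)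
  obtain rfl := Finset.mem_singleton.mp (Finsupp.support_single_subset hb)
  exact add_neg_of_nonpos_of_neg (hT b₁ hb₁) (hS b₂ hb₂)
end

section
/- (S_i^G product rule.) Let G : (Fin k → ℤ) →+ (Fin k → ℝ) be an additive map (such as the restriction to the integer lattice of an invertible linear transformation of ℝ^k), let i ≤ k, and let T : (Fin k → ℤ) →₀ M and S : (Fin k → ℤ) →₀ N be boost-weight decomposed tensors over a commutative ring R both possessing the S_i^G-property with the same G. Then for any R-bilinear map B : M → N → P, the product T·S possesses the S_i^G-property with the same G. -/
/-- `S_i^G` product rule: given an additive transformation `G` of the boost weights,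
if `T` and `S` both possess the `S_i^G`-property (every `b` in the support has the
first `i` entries of `G b` lexicographically `≤ 0`), with the same `G`, then for any
bilinear map `B` the product `T·S` possesses the `S_i^G`-property with the same `G`. -/
theorem boostProd_sPropG_of_sPropG_sPropG {k : ℕ} {R M N P : Type*} [CommRing R]
    [AddCommGroup M] [Module R M] [AddCommGroup N] [Module R N]
    [AddCommGroup P] [Module R P] (B : M →ₗ[R] N →ₗ[R] P)
    (G : (Fin k → ℤ) →+ (Fin k → ℝ)) {i : ℕ} (hik : i ≤ k)
    (T : (Fin k → ℤ) →₀ M) (S : (Fin k → ℤ) →₀ N)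
    (hT : ∀ b ∈ T.support, toLex (G b ∘ Fin.castLE hik) ≤ toLex 0)
    (hS : ∀ b ∈ S.support, toLex (G b ∘ Fin.castLE hik) ≤ toLex 0) :
    ∀ b ∈ (boostProd B T S).support, toLex (G b ∘ Fin.castLE hik) ≤ toLex 0 := by
  classical
  intro b hb
  obtain ⟨b₁, h₁, hb⟩ := Finset.mem_biUnion.mp (Finsupp.support_sum hb)
  obtain ⟨b₂, h₂, hb⟩ := Finset.mem_biUnion.mp (Finsupp.support_sum hb)
  obtain rfl : b = b₁ + b₂ := Finset.mem_singleton.mp (Finsupp.support_single_subset hb)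
  rw [map_add]
  exact add_nonpos (hT b₁ h₁) (hS b₂ h₂)
end

section
/- (Abstract form of 'the N-property implies VSI'.) Let V be a finite-dimensional vector space over a field K, let ι be a linearly ordered type, let s be a finite subset of ι, and let W : ι → Submodule K V be a family of subspaces with ⨆_{b ∈ s} W b = ⊤. Let T : V →ₗ[K] V satisfy: for every b ∈ s, the image of W b under T is contained in ⨆_{c ∈ s, c < b} W c. Then every polynomial invariant of T vanishes: trace(T^m) = 0 for all m ≥ 1. -/
/-- If `T` maps each `W b` into the span of the `W c` with `c < b`, then `T ^ n` kills every `W b`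
with fewer than `n` indices of `s` below `b`. -/
theorem Submodule.le_ker_pow_of_map_le_iSup_lt {R M ι : Type*} [Semiring R] [AddCommMonoid M]
    [Module R M] [LinearOrder ι] {s : Finset ι} {W : ι → Submodule R M} {T : M →ₗ[R] M}
    (hT : ∀ b ∈ s, Submodule.map T (W b) ≤ ⨆ c ∈ s, ⨆ (_ : c < b), W c)
    (n : ℕ) {b : ι} (hb : b ∈ s) (hn : (s.filter (· < b)).card < n) :
    W b ≤ LinearMap.ker (T ^ n) := by
  induction n generalizing b with
  | zero => simp at hn
  | succ n ih =>
    have hle : Submodule.map T (W b) ≤ LinearMap.ker (T ^ n) := by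
      refine (hT b hb).trans (iSup₂_le fun c hc => iSup_le fun hcb => ih hc ?_)
      refine (Finset.card_lt_card ?_).trans_le (Nat.lt_succ_iff.mp hn)
      refine Finset.ssubset_iff_of_subset (fun d hd => ?_) |>.mpr ⟨c, by simp [hc, hcb], by simp⟩
      rw [Finset.mem_filter] at hd ⊢
      exact ⟨hd.1, hd.2.trans hcb⟩
    rwa [pow_succ, Module.End.mul_eq_comp, LinearMap.ker_comp, ← Submodule.map_le_iff_le_comap]

/-- An endomorphism that strictly lowers a finite spanning family of submodules is nilpotent. -/
theorem LinearMap.isNilpotent_of_map_le_iSup_lt {R M ι : Type*} [Semiring R] [AddCommMonoid M]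
    [Module R M] [LinearOrder ι] {s : Finset ι} {W : ι → Submodule R M}
    (hW : (⨆ b ∈ s, W b) = ⊤) {T : M →ₗ[R] M}
    (hT : ∀ b ∈ s, Submodule.map T (W b) ≤ ⨆ c ∈ s, ⨆ (_ : c < b), W c) :
    IsNilpotent T := by
  refine ⟨s.card, LinearMap.ker_eq_top.mp (top_le_iff.mp (hW ▸ iSup₂_le fun b hb => ?_))⟩
  refine Submodule.le_ker_pow_of_map_le_iSup_lt hT _ hb (Finset.card_lt_card ?_)
  exact Finset.filter_ssubset.mpr ⟨b, hb, lt_irrefl b⟩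

/-- Abstract form of "the N-property implies VSI": if a finite family of subspaces `W b`,
indexed by a finite subset `s` of a linearly ordered type, spans the finite-dimensional
space `V`, and the endomorphism `T` strictly lowers the grading, then all polynomial
invariants of `T` vanish: `trace (T ^ m) = 0` for every `m ≥ 1`. -/
theorem trace_pow_eq_zero_of_strictly_lowers_grading
    {K V ι : Type*} [Field K] [AddCommGroup V] [Module K V] [FiniteDimensional K V]
    [LinearOrder ι]
    (s : Finset ι) (W : ι → Submodule K V)
    (hW : (⨆ b ∈ s, W b) = ⊤)
    (T : V →ₗ[K] V)
    (hT : ∀ b ∈ s, Submodule.map T (W b) ≤ ⨆ c ∈ s, ⨆ (_ : c < b), W c) :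
    ∀ m : ℕ, 1 ≤ m → LinearMap.trace K V (T ^ m) = 0 := by
  intro m hm
  have hTm : IsNilpotent (T ^ m) :=
    (LinearMap.isNilpotent_of_map_le_iSup_lt hW hT).pow_of_pos (Nat.one_le_iff_ne_zero.mp hm)
  exact (LinearMap.isNilpotent_trace_of_isNilpotent hTm).eq_zero
end

section
/- (The one-form W^{1,(1)} of Case 1 is exact: W^{1,(1)} = dφ.) Fix real numbers V, x, U and functions C, D, E : ℝ → ℝ such that C and D have derivatives C' and D' at U and E has derivative D U at U. Suppose x > 0 and Q := V + C U * x + D U * x² > 0. Define φ(V, x, U) = 2 * log x − 2 * log (V + C U * x + D U * x²) + 2 * E U. Then: (i) the function V' ↦ φ(V', x, U) has derivative −2/Q at V; (ii) the function x' ↦ φ(V, x', U) has derivative 2*(V − D U * x²)/(Q * x) at x; and (iii) the function U' ↦ φ(V, x, U') has derivative 2*(D U * V + x*(C U * D U − C') + x²*((D U)² − D'))/Q at U. -/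
/-- The one-form `W^{1,(1)}` of Case 1 of the `(2,3)`-signature VSI metrics is exact:
with `φ(V,x,U) = 2 log x − 2 log (V + C(U) x + D(U) x²) + 2 ∫ D dU` (where `E` is an
antiderivative of `D`), the partial derivatives of `φ` are exactly the components of
`W^{1,(1)} = −2 dV/Q + 2 (V − D x²) dx/(Q x)
  + 2 (D V + x (C D − C') + x² (D² − D')) dU/Q`, where `Q = V + C x + D x²`. -/
theorem wOneForm_eq_dPhi
    (V x U : ℝ) (C D E : ℝ → ℝ) (C' D' : ℝ)
    (hC : HasDerivAt C C' U) (hD : HasDerivAt D D' U) (hE : HasDerivAt E (D U) U)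
    (hx : 0 < x) (hQ : 0 < V + C U * x + D U * x ^ 2) :
    HasDerivAt (fun V' => 2 * Real.log x - 2 * Real.log (V' + C U * x + D U * x ^ 2)
        + 2 * E U)
      (-2 / (V + C U * x + D U * x ^ 2)) V ∧
    HasDerivAt (fun x' => 2 * Real.log x' - 2 * Real.log (V + C U * x' + D U * x' ^ 2)
        + 2 * E U)
      (2 * (V - D U * x ^ 2) / ((V + C U * x + D U * x ^ 2) * x)) x ∧
    HasDerivAt (fun U' => 2 * Real.log x - 2 * Real.log (V + C U' * x + D U' * x ^ 2)
        + 2 * E U')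
      (2 * (D U * V + x * (C U * D U - C') + x ^ 2 * ((D U) ^ 2 - D'))
        / (V + C U * x + D U * x ^ 2)) U := by
  have hQ0 := hQ.ne'
  have hx0 := hx.ne'
  refine ⟨?_, ?_, ?_⟩
  · have hQV : HasDerivAt (fun V' => V' + C U * x + D U * x ^ 2) 1 V :=
      ((hasDerivAt_id' V).add_const _).add_const _
    refine ((((hQV.log hQ0).const_mul 2).const_sub (2 * Real.log x)).add_const
      (2 * E U)).congr_deriv ?_
    ring
  · have hQx : HasDerivAt (fun x' => V + C U * x' + D U * x' ^ 2)
        (C U * 1 + D U * (2 * x)) x := by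
      refine ((((hasDerivAt_id' x).const_mul (C U)).const_add V).fun_add
        ((hasDerivAt_pow 2 x).const_mul (D U))).congr_deriv ?_
      norm_num
    refine ((((Real.hasDerivAt_log hx0).const_mul 2).fun_sub
      ((hQx.log hQ0).const_mul 2)).add_const (2 * E U)).congr_deriv ?_
    generalize hq : V + C U * x + D U * x ^ 2 = q at hQ0 ⊢
    field_simp
    rw [← hq]
    ring
  · have hQU : HasDerivAt (fun U' => V + C U' * x + D U' * x ^ 2)
        (C' * x + D' * x ^ 2) U :=
      ((hC.mul_const x).const_add V).fun_add (hD.mul_const (x ^ 2))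
    refine ((((hQU.log hQ0).const_mul 2).const_sub (2 * Real.log x)).fun_add
      (hE.const_mul 2)).congr_deriv ?_
    generalize hq : V + C U * x + D U * x ^ 2 = q at hQ0 ⊢
    field_simp
    rw [← hq]
    ring
end
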